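/- Let H be a finite simple graph, let v be a vertex of H, and let A be a set of vertices of H not containing v such that every a ∈ A is non-adjacent to v and has the same neighborhood as v (i.e., each a ∈ A is a non-adjacent twin of v). Let G be the subgraph of H induced on the vertices outside A. If G has an exposed outside-obstacle representation in which the point of v is an extreme point of the point set, then H has an exposed outside-obstacle representation in which the points of all vertices in A ∪ {v} are extreme points of the point set. -/

import Mathlib

noncomputable section

/-- The plane ℝ². -/
abbrev Plane : Type := EuclideanSpace ℝ (Fin 2)

/-- A point set is in general position if no three of its points are collinear. -/
def InGenPos (P : Set Plane) : Prop :=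
  ∀ p ∈ P, ∀ q ∈ P, ∀ r ∈ P, p ≠ q → p ≠ r → q ≠ r →
    ¬ Collinear ℝ ({p, q, r} : Set Plane)

/-- The union of the closed segments corresponding to the edges of `G`
in the straight-line drawing given by `f`. -/
def edgeUnion {V : Type} (G : SimpleGraph V) (f : V → Plane) : Set Plane :=
  ⋃ (u : V) (v : V) (_ : G.Adj u v), segment ℝ (f u) (f v)

/-- The unbounded connected component of the complement of the drawing. -/
def outsideRegion {V : Type} (G : SimpleGraph V) (f : V → Plane) : Set Plane :=
  {p | p ∈ (edgeUnion G f)ᶜ ∧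
       ¬ Bornology.IsBounded (connectedComponentIn (edgeUnion G f)ᶜ p)}

/-- `(f, C)` is a single-obstacle representation of `G`. -/
def IsObstacleRep {V : Type} (G : SimpleGraph V) (f : V → Plane) (C : Set Plane) : Prop :=
  Function.Injective f ∧ InGenPos (Set.range f) ∧
  IsOpen C ∧ IsConnected C ∧ Disjoint C (Set.range f) ∧
  ∀ u v : V, u ≠ v → (G.Adj u v ↔ Disjoint (segment ℝ (f u) (f v)) C)

/-- An outside-obstacle representation: the obstacle lies in the unbounded component. -/
def IsOutsideObstacleRep {V : Type} (G : SimpleGraph V) (f : V → Plane) (C : Set Plane) : Prop :=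
  IsObstacleRep G f C ∧ C ⊆ outsideRegion G f

/-- An inside-obstacle representation: the obstacle avoids the unbounded component. -/
def IsInsideObstacleRep {V : Type} (G : SimpleGraph V) (f : V → Plane) (C : Set Plane) : Prop :=
  IsObstacleRep G f C ∧ Disjoint C (outsideRegion G f)

/-- An exposed outside-obstacle representation: every vertex lies on the boundary of
the unbounded component. -/
def IsExposedOutsideObstacleRep {V : Type} (G : SimpleGraph V) (f : V → Plane)
    (C : Set Plane) : Prop :=
  IsOutsideObstacleRep G f C ∧ ∀ v : V, f v ∈ closure (outsideRegion G f)

/-- `p` is an extreme point ("on the convex hull") of the point set `P`. -/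
def IsExtremePt (p : Plane) (P : Set Plane) : Prop :=
  p ∉ convexHull ℝ (P \ {p})

/-- `S` has at least `n` connected components. -/
def AtLeastNComponents (S : Set Plane) (n : ℕ) : Prop :=
  ∃ p : Fin n → Plane, (∀ i, p i ∈ S) ∧
    ∀ i j : Fin n, i ≠ j →
      connectedComponentIn S (p i) ≠ connectedComponentIn S (p j)

/-- `S` has exactly `n` connected components. -/
def ExactlyNComponents (S : Set Plane) (n : ℕ) : Prop :=
  ∃ p : Fin n → Plane, (∀ i, p i ∈ S) ∧
    (∀ i j : Fin n, i ≠ j →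
      connectedComponentIn S (p i) ≠ connectedComponentIn S (p j)) ∧
    ∀ q ∈ S, ∃ i : Fin n, connectedComponentIn S q = connectedComponentIn S (p i)

/-- The convex hulls of `A` and `B` are at least `t`-crossing. -/
def AtLeastCrossing (A B : Set Plane) (t : ℕ) : Prop :=
  ((convexHull ℝ A) ∩ (convexHull ℝ B)).Nonempty ∧
    AtLeastNComponents ((convexHull ℝ A) \ (convexHull ℝ B)) (t + 1)

/-- The convex hulls of `A` and `B` are exactly `t`-crossing. -/
def ExactlyCrossing (A B : Set Plane) (t : ℕ) : Prop :=
  ((convexHull ℝ A) ∩ (convexHull ℝ B)).Nonempty ∧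
    ExactlyNComponents ((convexHull ℝ A) \ (convexHull ℝ B)) (t + 1)


/-- Points outside `E` whose component in the complement is unbounded. -/
def unb (E : Set Plane) : Set Plane :=
  {p | p ∈ Eᶜ ∧ ¬ Bornology.IsBounded (connectedComponentIn Eᶜ p)}

lemma plane_rank : 1 < Module.rank ℝ Plane := by
  rw [← Module.finrank_eq_rank]
  simp

lemma unb_of_unbounded {E S : Set Plane} {z : Plane} (hS : IsPreconnected S) (hz : z ∈ S)
    (hd : S ⊆ Eᶜ) (hb : ¬ Bornology.IsBounded S) : z ∈ unb E :=
  ⟨hd hz, fun h => hb (h.subset (hS.subset_connectedComponentIn hz hd))⟩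

lemma unb_of_joined {E S : Set Plane} {z q : Plane} (hS : IsPreconnected S) (hz : z ∈ S)
    (hd : S ⊆ Eᶜ) (hq : q ∈ S) (hqU : q ∈ unb E) : z ∈ unb E := by
  refine ⟨hd hz, ?_⟩
  have h1 : q ∈ connectedComponentIn Eᶜ z := hS.subset_connectedComponentIn hz hd hq
  rw [connectedComponentIn_eq h1]
  exact hqU.2

lemma ext_preconnected {R : ℝ} (hR : 0 < R) : IsPreconnected {x : Plane | R ≤ ‖x‖} := by
  have h0 := (isConnected_compl_singleton_of_one_lt_rank plane_rank (0 : Plane)).isPreconnected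
  have : {x : Plane | R ≤ ‖x‖} = (fun x : Plane => (max 1 (R / ‖x‖)) • x) '' {0}ᶜ := by
    ext x
    constructor
    · intro hx
      have hx' : R ≤ ‖x‖ := hx
      have hpos : 0 < ‖x‖ := lt_of_lt_of_le hR hx'
      refine ⟨x, by simpa using hpos, ?_⟩
      have : max 1 (R / ‖x‖) = 1 := max_eq_left ((div_le_one hpos).2 hx')
      simp [this]
    · rintro ⟨y, hy, rfl⟩
      have hpos : 0 < ‖y‖ := norm_pos_iff.2 hy
      show R ≤ ‖_‖
      rw [norm_smul, Real.norm_eq_abs, abs_of_pos (lt_of_lt_of_le one_pos (le_max_left _ _))]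
      calc R = R / ‖y‖ * ‖y‖ := by field_simp
        _ ≤ _ := by gcongr; exact le_max_right _ _
  rw [this]
  apply h0.image
  intro x hx
  have : ‖x‖ ≠ 0 := by simpa using hx
  apply ContinuousAt.continuousWithinAt
  fun_prop (disch := assumption)

lemma ext_unbounded (R : ℝ) : ¬ Bornology.IsBounded {x : Plane | R ≤ ‖x‖} := by
  intro h
  obtain ⟨M, hM⟩ := h.exists_norm_le
  obtain ⟨x, hx⟩ := NormedSpace.exists_lt_norm ℝ Plane (max R M)
  have := hM x ((le_max_left _ _).trans hx.le)
  exact absurd (lt_of_le_of_lt (le_max_right R M) hx) (not_lt.2 this)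

lemma exists_far {S : Set Plane} (h : ¬ Bornology.IsBounded S) (R : ℝ) :
    ∃ y ∈ S, R ≤ ‖y‖ := by
  by_contra hc
  push Not at hc
  exact h (isBounded_iff_forall_norm_le.2 ⟨R, fun x hx => (hc x hx).le⟩)

lemma exists_bound {E : Set Plane} (hE : IsCompact E) :
    ∃ R : ℝ, 0 < R ∧ {x : Plane | R ≤ ‖x‖} ⊆ Eᶜ := by
  obtain ⟨M, hM⟩ := hE.isBounded.exists_norm_le
  refine ⟨max 1 (M + 1), by positivity, fun x hx hxE => ?_⟩
  have h1 := hM x hxE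
  have h2 : max 1 (M + 1) ≤ ‖x‖ := hx
  have := (le_max_right 1 (M + 1)).trans h2
  linarith

lemma ext_subset_unb {E : Set Plane} {R : ℝ} (hR : 0 < R)
    (h : {x : Plane | R ≤ ‖x‖} ⊆ Eᶜ) : {x : Plane | R ≤ ‖x‖} ⊆ unb E := fun _ hx =>
  unb_of_unbounded (ext_preconnected hR) hx h (ext_unbounded R)

lemma exists_eq_component {E : Set Plane} (hE : IsCompact E) :
    ∃ z, z ∈ Eᶜ ∧ unb E = connectedComponentIn Eᶜ z := by
  obtain ⟨R, hR, hRE⟩ := exists_bound hE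
  obtain ⟨z, -, hz⟩ := exists_far (ext_unbounded R) R
  have hzU := ext_subset_unb hR hRE hz
  refine ⟨z, hRE hz, ?_⟩
  ext x
  constructor
  · rintro ⟨hx, hb⟩
    obtain ⟨y, hy, hyR⟩ := exists_far hb R
    have h1 := (ext_preconnected hR).subset_connectedComponentIn hz hRE hyR
    rw [connectedComponentIn_eq h1, ← connectedComponentIn_eq hy]
    exact mem_connectedComponentIn hx
  · intro hx
    exact unb_of_joined isPreconnected_connectedComponentIn hx
      (connectedComponentIn_subset _ _) (mem_connectedComponentIn (hRE hz)) hzU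

lemma unb_isOpen {E : Set Plane} (hE : IsCompact E) : IsOpen (unb E) := by
  obtain ⟨z, -, h⟩ := exists_eq_component hE
  rw [h]
  exact hE.isClosed.isOpen_compl.connectedComponentIn

lemma unb_isConnected {E : Set Plane} (hE : IsCompact E) : IsConnected (unb E) := by
  obtain ⟨z, hz, h⟩ := exists_eq_component hE
  rw [h]
  exact ⟨⟨z, mem_connectedComponentIn hz⟩, isPreconnected_connectedComponentIn⟩

/-- Robustness of membership in the unbounded component. -/
lemma unb_stable {E : Set Plane} (hE : IsCompact E) {z : Plane} (hz : z ∈ unb E) :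
    ∃ δ > 0, ∀ E' : Set Plane, E' ⊆ Metric.thickening δ E → Metric.ball z δ ⊆ unb E' := by
  obtain ⟨R, hR, hRE⟩ := exists_bound hE
  have hpc := ((unb_isOpen hE).isConnected_iff_isPathConnected).1 (unb_isConnected hE)
  obtain ⟨y, -, hyR⟩ := exists_far (ext_unbounded R) R
  obtain ⟨γ, hγ⟩ := hpc.joinedIn z hz y (ext_subset_unb hR hRE hyR)
  set S : Set Plane := Set.range γ ∪ {x : Plane | R ≤ ‖x‖} with hS
  have hSpre : IsPreconnected S := by
    refine IsPreconnected.union y ⟨1, γ.target⟩ hyR (isPreconnected_range γ.continuous) 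
      (ext_preconnected hR)
  have hSc : IsClosed S := (isCompact_range γ.continuous).isClosed.union
    (isClosed_le continuous_const continuous_norm)
  have hd : Disjoint E S := by
    rw [Set.disjoint_right]
    rintro x (⟨t, rfl⟩ | hx)
    · exact (hγ t).1
    · exact hRE hx
  obtain ⟨δ, hδ, hδd⟩ := hd.exists_thickenings hE hSc
  have hzS : z ∈ S := Or.inl ⟨0, γ.source⟩
  refine ⟨δ, hδ, fun E' hE' w hw => ?_⟩
  have hpre : IsPreconnected (S ∪ Metric.ball z δ) :=
    IsPreconnected.union z hzS (Metric.mem_ball_self hδ) hSpre (convex_ball z δ).isPreconnected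
  refine unb_of_unbounded hpre (Or.inr hw) ?_ ?_
  · intro x hx hxE
    refine Set.disjoint_left.1 hδd (hE' hxE) ?_
    rcases hx with hx | hx
    · exact Metric.self_subset_thickening hδ _ hx
    · exact Metric.mem_thickening_iff.2 ⟨z, hzS, hx⟩
  · intro hb
    exact ext_unbounded R (hb.subset (fun x hx => Or.inl (Or.inr hx)))

lemma punctured_ball (x : Plane) {r : ℝ} (hr : 0 < r) :
    IsPreconnected (Metric.ball x r \ {x}) := by
  have h0 := (isConnected_compl_singleton_of_one_lt_rank plane_rank (0 : Plane)).isPreconnected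
  have : Metric.ball x r \ {x} = (OpenPartialHomeomorph.univBall x r) '' {0}ᶜ := by
    have ht := OpenPartialHomeomorph.univBall_target x hr
    have hs := OpenPartialHomeomorph.univBall_source x r
    have h0 := OpenPartialHomeomorph.univBall_apply_zero x r
    ext y
    constructor
    · rintro ⟨hy, hyx⟩
      rw [← ht] at hy
      refine ⟨(OpenPartialHomeomorph.univBall x r).symm y, ?_,
        (OpenPartialHomeomorph.univBall x r).right_inv hy⟩
      intro h
      apply hyx
      have h2 := (OpenPartialHomeomorph.univBall x r).right_inv hy
      rw [Set.mem_singleton_iff.1 h, h0] at h2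
      exact h2.symm
    · rintro ⟨w, hw, rfl⟩
      refine ⟨?_, ?_⟩
      · rw [← ht]
        exact (OpenPartialHomeomorph.univBall x r).map_source (by rw [hs]; trivial)
      · intro h
        apply hw
        rw [Set.mem_singleton_iff] at h
        exact (OpenPartialHomeomorph.univBall x r).injOn (by rw [hs]; trivial)
          (by rw [hs]; trivial) (h.trans h0.symm)
  rw [this]
  exact h0.image _ (OpenPartialHomeomorph.continuous_univBall x r).continuousOn

lemma punctured_preconnected {U : Set Plane} (hU : IsOpen U) (hc : IsPreconnected U)
    (x : Plane) : IsPreconnected (U \ {x}) := by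
  by_cases hx : x ∈ U
  swap
  · rwa [Set.sdiff_singleton_eq_self hx]
  obtain ⟨r, hr, hrU⟩ := Metric.isOpen_iff.1 hU x hx
  have hD := punctured_ball x hr
  have key : ∀ A B : Set Plane, IsOpen A → IsOpen B → U \ {x} ⊆ A ∪ B →
      ((U \ {x}) ∩ A).Nonempty → ((U \ {x}) ∩ B).Nonempty → (Metric.ball x r \ {x}) ⊆ A → 
      ((U \ {x}) ∩ (A ∩ B)).Nonempty := by
    intro A B hA hB hAB hAn hBn hDA
    obtain ⟨b, hb, hbB⟩ := hBn
    obtain ⟨y, hyU, hy1, hy2⟩ := hc (A ∪ Metric.ball x r) (B \ {x}) (hA.union Metric.isOpen_ball)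
      (hB.sdiff isClosed_singleton) (by
        intro y hy
        by_cases hyx : y = x
        · exact Or.inl (Or.inr (by rw [hyx]; exact Metric.mem_ball_self hr))
        · rcases hAB ⟨hy, hyx⟩ with h | h
          · exact Or.inl (Or.inl h)
          · exact Or.inr ⟨h, hyx⟩) ⟨x, hx, Or.inr (Metric.mem_ball_self hr)⟩
      ⟨b, hb.1, hbB, hb.2⟩
    refine ⟨y, ⟨hyU, hy2.2⟩, ?_, hy2.1⟩
    rcases hy1 with h | h
    · exact h
    · exact hDA ⟨h, hy2.2⟩
  intro A B hA hB hAB hAn hBn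
  by_contra hcon
  have hsub : Metric.ball x r \ {x} ⊆ A ∪ B := fun y hy => hAB ⟨hrU hy.1, hy.2⟩
  have hdis : ¬ ((Metric.ball x r \ {x}) ∩ (A ∩ B)).Nonempty := by
    rintro ⟨y, hy, hy2⟩
    exact hcon ⟨y, ⟨hrU hy.1, hy.2⟩, hy2⟩
  by_cases h1 : ((Metric.ball x r \ {x}) ∩ A).Nonempty
  · by_cases h2 : ((Metric.ball x r \ {x}) ∩ B).Nonempty
    · exact hdis (hD A B hA hB hsub h1 h2)
    · refine hcon (key A B hA hB hAB hAn hBn fun y hy => ?_)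
      rcases hsub hy with h | h
      · exact h
      · exact absurd ⟨y, hy, h⟩ h2
  · have := key B A hB hA (by rwa [Set.union_comm]) hBn hAn fun y hy => by
      rcases hsub hy with h | h
      · exact absurd ⟨y, hy, h⟩ h1
      · exact h
    rw [Set.inter_comm B A] at this
    exact hcon this

lemma diff_finite_preconnected {U : Set Plane} (hU : IsOpen U) (hc : IsPreconnected U)
    {F : Set Plane} (hF : F.Finite) : IsPreconnected (U \ F) := by
  induction F, hF using Set.Finite.induction_on with
  | empty => simpa using hc
  | @insert a s _ hs ih =>
    have : U \ insert a s = (U \ s) \ {a} := by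
      ext y
      simp only [Set.mem_sdiff, Set.mem_insert_iff, Set.mem_singleton_iff]
      tauto
    rw [this]
    exact punctured_preconnected (hU.sdiff hs.isClosed) ih a

/-- Two segments from a common origin `o`. -/
lemma ray_lemma {o q b x : Plane} (hx : x ∈ segment ℝ o q) (hxo : x ≠ o)
    (hxb : x ∈ segment ℝ o b) : q ∈ segment ℝ o b ∨ b ∈ segment ℝ o q := by
  rw [segment_eq_image'] at hx hxb
  obtain ⟨t, ⟨ht0, ht1⟩, rfl⟩ := hx
  obtain ⟨s, ⟨hs0, hs1⟩, h⟩ := hxb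
  have htne : t ≠ 0 := by rintro rfl; simp at hxo
  have h' : s • (b - o) = t • (q - o) := by simpa using h
  have hsne : s ≠ 0 := by
    rintro rfl
    rw [zero_smul] at h'
    exact hxo (by simp [← h'])
  rcases le_total s t with hst | hst
  · left
    rw [segment_eq_image']
    refine ⟨t⁻¹ * s, ⟨by positivity, ?_⟩, ?_⟩
    · have := lt_of_le_of_ne ht0 htne.symm
      rw [inv_mul_le_iff₀ this]; linarith
    · simp only [mul_smul, h', smul_smul, inv_mul_cancel₀ htne]
      simp
  · right
    rw [segment_eq_image']
    refine ⟨s⁻¹ * t, ⟨by positivity, ?_⟩, ?_⟩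
    · have := lt_of_le_of_ne hs0 hsne.symm
      rw [inv_mul_le_iff₀ this]; linarith
    · simp only [mul_smul, ← h', smul_smul, inv_mul_cancel₀ hsne]
      simp

lemma segment_isCompact (a b : Plane) : IsCompact (segment ℝ a b) := by
  rw [segment_eq_image']
  exact isCompact_Icc.image (by fun_prop)

lemma edgeUnion_isCompact {V : Type} [Finite V] (G : SimpleGraph V) (f : V → Plane) :
    IsCompact (edgeUnion G f) :=
  isCompact_iUnion fun _ => isCompact_iUnion fun _ => isCompact_iUnion fun _ =>
    segment_isCompact _ _

lemma mem_edgeUnion {V : Type} {G : SimpleGraph V} {f : V → Plane} {x : Plane} :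
    x ∈ edgeUnion G f ↔ ∃ u w, G.Adj u w ∧ x ∈ segment ℝ (f u) (f w) := by
  simp [edgeUnion]

lemma not_collinear_perm {a b c : Plane} (h : ¬ Collinear ℝ ({a, b, c} : Set Plane)) :
    ¬ Collinear ℝ ({b, a, c} : Set Plane) ∧ ¬ Collinear ℝ ({b, c, a} : Set Plane) := by
  constructor
  · rwa [Set.insert_comm]
  · rwa [show ({b, c, a} : Set Plane) = {a, b, c} by
      ext; simp only [Set.mem_insert_iff, Set.mem_singleton_iff]; tauto]

lemma collinear_of_mem_segment {a b c : Plane} (h : c ∈ segment ℝ a b) :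
    Collinear ℝ ({c, a, b} : Set Plane) := by
  apply collinear_insert_of_mem_affineSpan_pair
  have := (mem_segment_iff_wbtw.1 h).mem_affineSpan
  exact this

lemma collinear_det {a b c : Plane} (m l : Plane →L[ℝ] ℝ)
    (h : Collinear ℝ ({a, b, c} : Set Plane)) :
    (m b - m a) * (l c - l a) = (m c - m a) * (l b - l a) := by
  obtain ⟨v, hv⟩ := (collinear_iff_of_mem (k := ℝ) (p₀ := a) (by simp)).1 h
  obtain ⟨r, hr⟩ := hv b (by simp)
  obtain ⟨s, hs⟩ := hv c (by simp)
  rw [hr, hs]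
  simp only [vadd_eq_add, map_add, map_smul, smul_eq_mul]
  ring

/-- The obstacle of an outside representation may be taken to be everything outside. -/
lemma finish_rep {V : Type} [Finite V] (H : SimpleGraph V) (g : V → Plane)
    (hinj : Function.Injective g) (hgp : InGenPos (Set.range g))
    (hnon : ∀ x y, x ≠ y → ¬ H.Adj x y →
      (segment ℝ (g x) (g y) ∩ unb (edgeUnion H g)).Nonempty)
    (hexp : ∀ x, g x ∈ closure (unb (edgeUnion H g))) :
    IsExposedOutsideObstacleRep H g (unb (edgeUnion H g) \ Set.range g) := by
  have hE := edgeUnion_isCompact H g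
  have hfin : (Set.range g).Finite := Set.finite_range g
  have hopen := unb_isOpen hE
  refine ⟨⟨⟨hinj, hgp, hopen.sdiff hfin.isClosed, ⟨?_, ?_⟩, Set.disjoint_sdiff_left, ?_⟩,
    fun x hx => hx.1⟩, hexp⟩
  · obtain ⟨R, hR, hRE⟩ := exists_bound hE
    by_contra hne
    rw [Set.not_nonempty_iff_eq_empty, Set.sdiff_eq_empty] at hne
    exact ext_unbounded R (hfin.isBounded.subset ((ext_subset_unb hR hRE).trans hne))
  · exact diff_finite_preconnected hopen (unb_isConnected hE).isPreconnected hfin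
  · intro x y hxy
    constructor
    · intro hadj
      rw [Set.disjoint_left]
      intro z hz hz2
      exact hz2.1.1 (mem_edgeUnion.2 ⟨x, y, hadj, hz⟩)
    · intro hd
      by_contra hadj
      obtain ⟨z, hz, hzU⟩ := hnon x y hxy hadj
      rw [← closure_openSegment] at hz
      obtain ⟨w, hwU, hw⟩ := mem_closure_iff.1 hz _ hopen hzU
      have hws := openSegment_subset_segment ℝ _ _ hw
      refine Set.disjoint_left.1 hd hws ⟨hwU, ?_⟩
      have hne : g x ≠ g y := hinj.ne hxy
      intro hwr
      have hwx : w ≠ g x := by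
        rintro rfl
        exact hne (left_mem_openSegment_iff.1 hw)
      have hwy : w ≠ g y := by
        rintro rfl
        exact hne (right_mem_openSegment_iff.1 hw)
      exact hgp w hwr (g x) ⟨x, rfl⟩ (g y) ⟨y, rfl⟩ hwx hwy hne (collinear_of_mem_segment hws)

lemma exists_coords {S : Set Plane} (hS : S.Finite) {p : Plane} (hp : p ∉ convexHull ℝ S) :
    ∃ (m l : Plane →L[ℝ] ℝ) (e₁ e₂ : Plane), m e₁ = 1 ∧ m e₂ = 0 ∧ l e₁ = 0 ∧ l e₂ = 1 ∧
      ∀ x ∈ S, l p < l x := by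
  have h1 : ∃ l : Plane →L[ℝ] ℝ, l ≠ 0 ∧ ∀ x ∈ S, l p < l x := by
    rcases S.eq_empty_or_nonempty with rfl | ⟨s, hs⟩
    · refine ⟨EuclideanSpace.proj 0, ?_, by simp⟩
      intro h
      have := congrArg (fun l : Plane →L[ℝ] ℝ => l !₂[1, 0]) h
      simp at this
    · obtain ⟨l, u, hl, hu⟩ := geometric_hahn_banach_point_closed (convex_convexHull ℝ S)
        (hS.isClosed_convexHull ℝ) hp
      have hlt : ∀ x ∈ S, l p < l x := fun x hx => hl.trans (hu x (subset_convexHull ℝ S hx))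
      refine ⟨l, ?_, hlt⟩
      rintro rfl
      simpa using hlt s hs
  obtain ⟨l, hl0, hl⟩ := h1
  set a := l !₂[1, 0] with ha
  set b := l !₂[0, 1] with hb
  have hlx : ∀ x y : ℝ, l !₂[x, y] = x * a + y * b := by
    intro x y
    have : (!₂[x, y] : Plane) = x • !₂[1, 0] + y • !₂[0, 1] := by
      ext i; fin_cases i <;> simp
    rw [this, map_add, map_smul, map_smul]; rfl
  have hN : 0 < a ^ 2 + b ^ 2 := by
    by_contra hcon
    have ha0 : a = 0 := by nlinarith [sq_nonneg a, sq_nonneg b]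
    have hb0 : b = 0 := by nlinarith [sq_nonneg a, sq_nonneg b]
    apply hl0
    ext z
    have : z = !₂[z 0, z 1] := by ext i; fin_cases i <;> simp
    rw [this, hlx, ha0, hb0]; simp
  refine ⟨(a ^ 2 + b ^ 2)⁻¹ • (a • EuclideanSpace.proj (1 : Fin 2) -
    b • EuclideanSpace.proj (0 : Fin 2)), l, !₂[-b, a],
    !₂[a / (a ^ 2 + b ^ 2), b / (a ^ 2 + b ^ 2)], ?_, ?_, ?_, ?_, hl⟩
  · simp; field_simp
  · simp; right; ring
  · rw [hlx]; ring
  · rw [hlx]; field_simp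

open Filter Topology in
lemma eventually_unb_stable {E : Set Plane} (hE : IsCompact E) {z : Plane} (hz : z ∈ unb E) :
    ∀ᶠ ρ in 𝓝[>] (0 : ℝ), ∀ E' : Set Plane, E' ⊆ Metric.thickening ρ E →
      Metric.ball z ρ ⊆ unb E' := by
  obtain ⟨δ, hδ, h⟩ := unb_stable hE hz
  filter_upwards [Ioo_mem_nhdsGT hδ] with ρ hρ E' hE'
  exact (Metric.ball_subset_ball hρ.2.le).trans
    (h E' (hE'.trans (Metric.thickening_mono hρ.2.le E)))

lemma seg_close {a b a' b' z : Plane} {ρ : ℝ} (ha : dist a' a < ρ) (hb : dist b' b < ρ)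
    (hz : z ∈ segment ℝ a b) : ∃ z' ∈ segment ℝ a' b', dist z' z < ρ := by
  obtain ⟨s, t, hs, ht, hst, rfl⟩ := hz
  refine ⟨s • a' + t • b', ⟨s, t, hs, ht, hst, rfl⟩, ?_⟩
  rw [dist_eq_norm] at *
  have : s • a' + t • b' - (s • a + t • b) = s • (a' - a) + t • (b' - b) := by module
  rw [this]
  refine lt_of_le_of_lt (norm_add_le _ _) ?_
  rw [norm_smul, norm_smul, Real.norm_of_nonneg hs, Real.norm_of_nonneg ht]
  rcases hs.eq_or_lt with rfl | hs'
  · have : t = 1 := by linarith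
    subst this
    simpa using hb
  · nlinarith [norm_nonneg (b' - b)]

lemma segment_thick {a b a' b' : Plane} {ρ : ℝ} (ha : dist a' a < ρ) (hb : dist b' b < ρ) :
    segment ℝ a' b' ⊆ Metric.thickening ρ (segment ℝ a b) := by
  intro z hz
  obtain ⟨z', h1, h2⟩ := seg_close (a := a') (b := b') (a' := a) (b' := b) (z := z)
    (by rwa [dist_comm]) (by rwa [dist_comm]) hz
  exact Metric.mem_thickening_iff.2 ⟨z', h1, by rwa [dist_comm]⟩

lemma edgeUnion_thick {V : Type} (H : SimpleGraph V) {F g : V → Plane} {ρ : ℝ}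
    (hg : ∀ x, dist (g x) (F x) < ρ) :
    edgeUnion H g ⊆ Metric.thickening ρ (edgeUnion H F) := by
  intro z hz
  obtain ⟨u, w, huw, hz⟩ := mem_edgeUnion.1 hz
  exact Metric.thickening_subset_of_subset ρ
    (fun y hy => mem_edgeUnion.2 ⟨u, w, huw, hy⟩) (segment_thick (hg u) (hg w) hz)

open Filter Topology in
lemma perturb_wit {V : Type} [Finite V] (H : SimpleGraph V) (F : V → Plane) (x y : V)
    (h : (segment ℝ (F x) (F y) ∩ unb (edgeUnion H F)).Nonempty) :
    ∀ᶠ ρ in 𝓝[>] (0 : ℝ), ∀ g : V → Plane, (∀ x, dist (g x) (F x) < ρ) →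
      (segment ℝ (g x) (g y) ∩ unb (edgeUnion H g)).Nonempty := by
  obtain ⟨z, hz, hzU⟩ := h
  filter_upwards [eventually_unb_stable (edgeUnion_isCompact H F) hzU] with ρ hρ g hg
  obtain ⟨z', hz', hd⟩ := seg_close (hg x) (hg y) hz
  exact ⟨z', hz', hρ _ (edgeUnion_thick H hg) hd⟩

lemma exists_probe {V : Type} [Finite V] (H : SimpleGraph V) (F : V → Plane) (x : V)
    (hx : F x ∈ closure (unb (edgeUnion H F)))
    (hgp : ∀ u w, H.Adj u w → F x ∈ segment ℝ (F u) (F w) → u = x ∨ w = x) :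
    ∃ q ∈ unb (edgeUnion H F), ∀ y ∈ segment ℝ (F x) q, y ≠ F x → y ∉ edgeUnion H F := by
  set Z : Set Plane := (⋃ (u : V) (w : V) (_ : F x ∉ segment ℝ (F u) (F w)),
    segment ℝ (F u) (F w)) ∪ (Set.range F \ {F x}) with hZ
  have hZc : IsClosed Z := by
    apply IsClosed.union
    · exact (isCompact_iUnion fun _ => isCompact_iUnion fun _ => isCompact_iUnion fun _ =>
        segment_isCompact _ _).isClosed
    · exact ((Set.finite_range F).subset Set.sdiff_subset).isClosed
  have hxZ : F x ∉ Z := by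
    rintro (h | h)
    · simp only [Set.mem_iUnion] at h
      obtain ⟨u, w, h1, h2⟩ := h
      exact h1 h2
    · exact h.2 rfl
  obtain ⟨r, hr, hrZ⟩ := Metric.isOpen_iff.1 hZc.isOpen_compl (F x) hxZ
  obtain ⟨q, hqU, hqr⟩ := Metric.mem_closure_iff.1 hx r hr
  rw [dist_comm] at hqr
  have hsub : segment ℝ (F x) q ⊆ Zᶜ :=
    ((convex_ball (F x) r).segment_subset (Metric.mem_ball_self hr) hqr).trans hrZ
  refine ⟨q, hqU, fun y hy hyx hyE => ?_⟩
  have key : ∀ w, H.Adj x w → y ∈ segment ℝ (F x) (F w) → False := by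
    intro w hxw hyw
    rcases ray_lemma hy hyx hyw with h | h
    · exact hqU.1 (mem_edgeUnion.2 ⟨x, w, hxw, h⟩)
    · refine hsub h (Or.inr ⟨⟨w, rfl⟩, ?_⟩)
      intro hw
      rw [Set.mem_singleton_iff.1 hw] at hyw
      simp at hyw
      exact hyx hyw
  obtain ⟨u, w, huw, hyuw⟩ := mem_edgeUnion.1 hyE
  by_cases hxs : F x ∈ segment ℝ (F u) (F w)
  · rcases hgp u w huw hxs with rfl | rfl
    · exact key w huw hyuw
    · exact key u huw.symm (by rwa [segment_symm])
  · refine hsub hy (Or.inl ?_)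
    simp only [Set.mem_iUnion]
    exact ⟨u, w, hxs, hyuw⟩

open Filter Topology in
lemma perturb_exp {V : Type} [Finite V] (H : SimpleGraph V) (F : V → Plane) (x : V)
    (hx : F x ∈ closure (unb (edgeUnion H F)))
    (hne : ∀ w, H.Adj x w → F w ≠ F x)
    (hgp : ∀ u w, H.Adj u w → F x ∈ segment ℝ (F u) (F w) → u = x ∨ w = x) :
    ∀ᶠ ρ in 𝓝[>] (0 : ℝ), ∀ g : V → Plane, (∀ x, dist (g x) (F x) < ρ) → g x = F x →
      g x ∈ closure (unb (edgeUnion H g)) := by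
  obtain ⟨q, hqU, hq⟩ := exists_probe H F x hx hgp
  have e1 : ∀ᶠ ρ in 𝓝[>] (0 : ℝ), ∀ u w, H.Adj u w → F x ∉ segment ℝ (F u) (F w) →
      Disjoint (segment ℝ (F x) q) (Metric.thickening ρ (segment ℝ (F u) (F w))) := by
    refine eventually_all.2 fun u => eventually_all.2 fun w => ?_
    by_cases huw : H.Adj u w
    swap
    · exact Eventually.of_forall fun _ h => absurd h huw
    by_cases hxs : F x ∈ segment ℝ (F u) (F w)
    · exact Eventually.of_forall fun _ _ h => absurd hxs h
    have hd : Disjoint (segment ℝ (F x) q) (segment ℝ (F u) (F w)) := by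
      rw [Set.disjoint_left]
      intro y hy hy2
      by_cases hyx : y = F x
      · exact hxs (hyx ▸ hy2)
      · exact hq y hy hyx (mem_edgeUnion.2 ⟨u, w, huw, hy2⟩)
    obtain ⟨δ, hδ, h⟩ := hd.exists_thickenings (segment_isCompact _ _)
      (segment_isCompact _ _).isClosed
    filter_upwards [Ioo_mem_nhdsGT hδ] with ρ hρ _ _
    exact h.mono (Metric.self_subset_thickening hδ _) (Metric.thickening_mono hρ.2.le _)
  have e2 : ∀ᶠ ρ in 𝓝[>] (0 : ℝ), ∀ w, H.Adj x w → 
      Disjoint (segment ℝ (F x) q) (Metric.ball (F w) ρ) := by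
    refine eventually_all.2 fun w => ?_
    by_cases hxw : H.Adj x w
    swap
    · exact Eventually.of_forall fun _ h => absurd h hxw
    have hw : F w ∈ (segment ℝ (F x) q)ᶜ := fun h => hq _ h (hne w hxw)
      (mem_edgeUnion.2 ⟨x, w, hxw, right_mem_segment _ _ _⟩)
    obtain ⟨δ, hδ, h⟩ := Metric.isOpen_iff.1 (segment_isCompact (F x) q).isClosed.isOpen_compl _ hw
    filter_upwards [Ioo_mem_nhdsGT hδ] with ρ hρ _
    rw [Set.disjoint_right]
    intro y hy
    exact h (Metric.ball_subset_ball hρ.2.le hy)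
  filter_upwards [e1, e2, eventually_unb_stable (edgeUnion_isCompact H F) hqU,
    self_mem_nhdsWithin] with ρ h1 h2 h3 hρ g hg hgx
  have hρ' : 0 < ρ := hρ
  have hqU' : q ∈ unb (edgeUnion H g) := h3 _ (edgeUnion_thick H hg) (Metric.mem_ball_self hρ')
  have havoid : ∀ y ∈ segment ℝ (F x) q, y ≠ F x → y ∉ edgeUnion H g := by
    intro y hy hyx hyE
    have key : ∀ w, H.Adj x w → y ∈ segment ℝ (F x) (g w) → False := by
      intro w hxw hyw
      rcases ray_lemma hy hyx hyw with h | h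
      · exact hqU'.1 (mem_edgeUnion.2 ⟨x, w, hxw, by rwa [hgx]⟩)
      · exact Set.disjoint_left.1 (h2 w hxw) h (hg w)
    obtain ⟨u, w, huw, hyuw⟩ := mem_edgeUnion.1 hyE
    by_cases hxs : F x ∈ segment ℝ (F u) (F w)
    · rcases hgp u w huw hxs with rfl | rfl
      · exact key w huw (by rwa [← hgx])
      · exact key u huw.symm (by rwa [segment_symm, ← hgx])
    · exact Set.disjoint_left.1 (h1 u w huw hxs) hy (segment_thick (hg u) (hg w) hyuw)
  by_cases hqx : q = F x
  · rw [hgx, ← hqx]; exact subset_closure hqU'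
  rw [hgx]
  have hmem : F x ∈ closure (openSegment ℝ (F x) q) := by
    rw [closure_openSegment]; exact left_mem_segment _ _ _
  refine closure_mono (fun y hy => ?_) hmem
  refine unb_of_joined (S := segment ℝ (F x) q \ {F x}) (q := q) ?_ ?_ ?_ ?_ hqU'
  · have : segment ℝ (F x) q \ {F x} = (fun t : ℝ => F x + t • (q - F x)) '' Set.Ioc 0 1 := by
      rw [segment_eq_image']
      have hsub : q - F x ≠ 0 := sub_ne_zero.2 hqx
      ext z
      constructor
      · rintro ⟨⟨t, ht, rfl⟩, hz⟩
        refine ⟨t, ⟨lt_of_le_of_ne ht.1 ?_, ht.2⟩, rfl⟩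
        rintro rfl
        simp at hz
      · rintro ⟨t, ht, rfl⟩
        refine ⟨⟨t, ⟨ht.1.le, ht.2⟩, rfl⟩, ?_⟩
        simp [hsub, ht.1.ne']
    rw [this]
    exact isPreconnected_Ioc.image _ (by fun_prop)
  · refine ⟨openSegment_subset_segment ℝ _ _ hy, ?_⟩
    intro h
    rw [Set.mem_singleton_iff.1 h] at hy
    exact hqx (left_mem_openSegment_iff.1 hy).symm
  · rintro z ⟨hz, hzx⟩
    exact havoid z hz hzx
  · exact ⟨right_mem_segment _ _ _, hqx⟩

/-- Everything vertically below a point that is below all the cones lies outside. -/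
lemma below_unb {V : Type} (H : SimpleGraph V) (B : Set V) (hind : ∀ x ∈ B, ∀ y ∈ B, ¬ H.Adj x y)
    (g : V → Plane) (m l : Plane →L[ℝ] ℝ) (p e₂ : Plane) (hm : m e₂ = 0) (hl : l e₂ = 1)
    (τ : V → ℝ) (c : ℝ) (hc : 0 < c)
    (hgm : ∀ b ∈ B, m (g b) - m p = τ b) (hgl : ∀ b ∈ B, l (g b) - l p = τ b ^ 2)
    (hO : ∀ b ∈ B, ∀ w, w ∉ B →
      τ b ^ 2 + c * |m (g w) - m p - τ b| < l (g w) - l p)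
    {b₀ : V} (hb₀ : b₀ ∈ B) {z : Plane}
    (hz : ∀ b ∈ B, l z - l p < τ b ^ 2 + c * |m z - m p - τ b|) :
    z ∈ unb (edgeUnion H g) := by
  have hconv : ∀ b ∈ B, ∀ u w, 
      τ b ^ 2 + c * |m (g u) - m p - τ b| ≤ l (g u) - l p →
      τ b ^ 2 + c * |m (g w) - m p - τ b| ≤ l (g w) - l p →
      ∀ y ∈ segment ℝ (g u) (g w), τ b ^ 2 + c * |m y - m p - τ b| ≤ l y - l p := by
    rintro b - u w hu hw y ⟨s, t, hs, ht, hst, rfl⟩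
    simp only [map_add, map_smul, smul_eq_mul]
    have e1 : s * m (g u) + t * m (g w) - m p - τ b
        = s * (m (g u) - m p - τ b) + t * (m (g w) - m p - τ b) := by
      linear_combination (m p + τ b) * hst
    have e2 : s * l (g u) + t * l (g w) - l p = s * (l (g u) - l p) + t * (l (g w) - l p) := by
      linear_combination (l p) * hst
    have e3 : τ b ^ 2 = s * τ b ^ 2 + t * τ b ^ 2 := by
      linear_combination (-τ b ^ 2) * hst
    rw [e1, e2, e3]
    have h1 : |s * (m (g u) - m p - τ b) + t * (m (g w) - m p - τ b)|
        ≤ s * |m (g u) - m p - τ b| + t * |m (g w) - m p - τ b| := by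
      refine (abs_add_le _ _).trans ?_
      rw [abs_mul, abs_mul, abs_of_nonneg hs, abs_of_nonneg ht]
    have h2 := mul_le_mul_of_nonneg_left h1 hc.le
    have h3 := mul_le_mul_of_nonneg_left hu hs
    have h4 := mul_le_mul_of_nonneg_left hw ht
    linarith
  have hapex : ∀ b ∈ B, τ b ^ 2 + c * |m (g b) - m p - τ b| ≤ l (g b) - l p := by
    intro b hb
    rw [hgm b hb, hgl b hb]; simp
  have hedge : ∀ y ∈ edgeUnion H g, ∃ b ∈ B, τ b ^ 2 + c * |m y - m p - τ b| ≤ l y - l p := by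
    intro y hy
    obtain ⟨u, w, huw, hy⟩ := mem_edgeUnion.1 hy
    by_cases hu : u ∈ B
    · have hw : w ∉ B := fun hw => hind u hu w hw huw
      exact ⟨u, hu, hconv u hu u w (hapex u hu) (hO u hu w hw).le y hy⟩
    · by_cases hw : w ∈ B
      · exact ⟨w, hw, hconv w hw u w (hO w hw u hu).le (hapex w hw) y hy⟩
      · exact ⟨b₀, hb₀, hconv b₀ hb₀ u w (hO b₀ hb₀ u hu).le (hO b₀ hb₀ w hw).le y hy⟩
  refine unb_of_unbounded (S := (fun t : ℝ => z - t • e₂) '' Set.Ici 0) ?_ ?_ ?_ ?_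
  · exact isPreconnected_Ici.image _ (by fun_prop)
  · exact ⟨0, by simp, by simp⟩
  · rintro _ ⟨t, ht, rfl⟩ hE
    obtain ⟨b, hb, h⟩ := hedge _ hE
    have ht' : 0 ≤ t := ht
    simp only [map_sub, map_smul, smul_eq_mul, hm, hl, mul_zero, sub_zero, mul_one] at h
    linarith [hz b hb]
  · intro hbd
    obtain ⟨M, hM⟩ := hbd.exists_norm_le
    have he2 : 0 < ‖e₂‖ := norm_pos_iff.2 (by rintro rfl; simp at hl)
    have hM0 := hM _ ⟨0, by simp, rfl⟩
    have hM0' : 0 ≤ M := (norm_nonneg _).trans hM0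
    set t := (M + ‖z‖ + 1) / ‖e₂‖ with ht
    have htp : 0 ≤ t := by positivity
    have h1 := hM _ ⟨t, htp, rfl⟩
    have h2 : ‖t • e₂‖ ≤ ‖z - t • e₂‖ + ‖z‖ := by
      have := norm_sub_le (z - t • e₂) z
      rwa [show z - t • e₂ - z = -(t • e₂) by abel, norm_neg] at this
    rw [norm_smul, Real.norm_of_nonneg htp, ht, div_mul_cancel₀ _ he2.ne'] at h2
    linarith

lemma parab_lt {c r s : ℝ} (hr : |r| < c / 2) (hs : |s| < c / 2) (h : s ≠ r) :
    s ^ 2 < r ^ 2 + c * |s - r| := by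
  have h1 : |s + r| < c := lt_of_le_of_lt (abs_add_le _ _) (by linarith)
  have h2 : 0 < |s - r| := abs_pos.2 (sub_ne_zero.2 h)
  have h3 : s ^ 2 - r ^ 2 ≤ |s + r| * |s - r| := by
    rw [← abs_mul]
    exact (le_of_eq (by ring)).trans (le_abs_self _)
  nlinarith

/-- Slope comparison for small slopes. -/
lemma slope_lt {c a y : ℝ} (ha : |a| < c) : a * y ≤ c * |y| := by
  have := le_abs_self (a * y)
  rw [abs_mul] at this
  nlinarith [abs_nonneg y]

open Filter Topology in
lemma core {V : Type} [Fintype V] (H : SimpleGraph V) (B : Set V) (F : V → Plane) (p : Plane)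
    (hind : ∀ x ∈ B, ∀ y ∈ B, ¬ H.Adj x y)
    (hFB : ∀ b ∈ B, F b = p)
    (hFO : ∀ x, x ∉ B → F x ≠ p)
    (hinj : ∀ x, x ∉ B → ∀ y, y ∉ B → F x = F y → x = y)
    (hnc3 : ∀ x, x ∉ B → ∀ y, y ∉ B → ∀ z, z ∉ B → x ≠ y → x ≠ z → y ≠ z →
      ¬ Collinear ℝ ({F x, F y, F z} : Set Plane))
    (hnc2 : ∀ x, x ∉ B → ∀ y, y ∉ B → x ≠ y → ¬ Collinear ℝ ({p, F x, F y} : Set Plane))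
    (hnon : ∀ x y, x ≠ y → ¬ H.Adj x y → ¬ (x ∈ B ∧ y ∈ B) →
      (segment ℝ (F x) (F y) ∩ unb (edgeUnion H F)).Nonempty)
    (hexp : ∀ x, x ∉ B → F x ∈ closure (unb (edgeUnion H F)))
    (hext : p ∉ convexHull ℝ (F '' Bᶜ)) :
    ∃ (g : V → Plane) (C : Set Plane), IsExposedOutsideObstacleRep H g C ∧
      ∀ b ∈ B, IsExtremePt (g b) (Set.range g) := by
  classical
  obtain ⟨m, l, e₁, e₂, hm1, hm2, hl1, hl2, hlp⟩ := exists_coords (Set.toFinite _) hext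
  -- choice of `c`
  obtain ⟨c, hcO, hc⟩ : ∃ c : ℝ, (∀ w, w ∉ B → c * |m (F w) - m p| < l (F w) - l p) ∧ 0 < c := by
    have h1 : ∀ᶠ c in 𝓝[>] (0 : ℝ), ∀ w, w ∉ B → c * |m (F w) - m p| < l (F w) - l p := by
      refine eventually_all.2 fun w => ?_
      by_cases hw : w ∈ B
      · exact Eventually.of_forall fun _ h => absurd hw h
      have h2 : Tendsto (fun c : ℝ => c * |m (F w) - m p|) (𝓝[>] 0) (𝓝 (0 * |m (F w) - m p|)) :=
        (Continuous.tendsto (by fun_prop) 0).mono_left nhdsWithin_le_nhds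
      have h3 : 0 * |m (F w) - m p| < l (F w) - l p := by
        have := hlp (F w) ⟨w, hw, rfl⟩
        linarith
      filter_upwards [h2.eventually_lt_const h3] with c hc _ using hc
    exact (h1.and self_mem_nhdsWithin).exists
  -- choice of `ρ`
  have hseg : ∀ x, x ∉ B → ∀ u w, H.Adj u w → F x ∈ segment ℝ (F u) (F w) → u = x ∨ w = x := by
    intro x hx u w huw hs
    by_contra hcon
    push Not at hcon
    have hcol := collinear_of_mem_segment hs
    by_cases hu : u ∈ B
    · have hw : w ∉ B := fun hw => hind u hu w hw huw
      rw [hFB u hu] at hcol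
      exact (not_collinear_perm (hnc2 x hx w hw hcon.2.symm)).1 hcol
    · by_cases hw : w ∈ B
      · rw [hFB w hw] at hcol
        exact (not_collinear_perm (hnc2 x hx u hu hcon.1.symm)).2 hcol
      · exact hnc3 x hx u hu w hw hcon.1.symm hcon.2.symm huw.ne hcol
  obtain ⟨ρ, ⟨hρ1, hρ2⟩, hρ⟩ : ∃ ρ : ℝ, ((∀ x y, x ≠ y → ¬ H.Adj x y → ¬ (x ∈ B ∧ y ∈ B) →
        ∀ g : V → Plane, (∀ x, dist (g x) (F x) < ρ) →
        (segment ℝ (g x) (g y) ∩ unb (edgeUnion H g)).Nonempty) ∧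
      (∀ x, x ∉ B → ∀ g : V → Plane, (∀ x, dist (g x) (F x) < ρ) → g x = F x →
        g x ∈ closure (unb (edgeUnion H g)))) ∧ 0 < ρ := by
    have h1 : ∀ᶠ ρ in 𝓝[>] (0 : ℝ), ∀ x y, x ≠ y → ¬ H.Adj x y → ¬ (x ∈ B ∧ y ∈ B) →
        ∀ g : V → Plane, (∀ x, dist (g x) (F x) < ρ) →
        (segment ℝ (g x) (g y) ∩ unb (edgeUnion H g)).Nonempty := by
      refine eventually_all.2 fun x => eventually_all.2 fun y => ?_
      by_cases h : x ≠ y ∧ ¬ H.Adj x y ∧ ¬ (x ∈ B ∧ y ∈ B)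
      · filter_upwards [perturb_wit H F x y (hnon x y h.1 h.2.1 h.2.2)] with ρ hρ _ _ _ using hρ
      · exact Eventually.of_forall fun _ a b c => absurd ⟨a, b, c⟩ h
    have h2 : ∀ᶠ ρ in 𝓝[>] (0 : ℝ), ∀ x, x ∉ B → ∀ g : V → Plane,
        (∀ x, dist (g x) (F x) < ρ) → g x = F x →
        g x ∈ closure (unb (edgeUnion H g)) := by
      refine eventually_all.2 fun x => ?_
      by_cases hx : x ∈ B
      · exact Eventually.of_forall fun _ h => absurd hx h
      filter_upwards [perturb_exp H F x (hexp x hx) (fun w hxw h => by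
        by_cases hw : w ∈ B
        · exact hFO x hx (by rw [← h, hFB w hw])
        · exact hxw.ne (hinj x hx w hw h.symm)) (hseg x hx)] with ρ hρ _ using hρ
    exact ((h1.and h2).and self_mem_nhdsWithin).exists
  -- the parabola
  set P : ℝ → Plane := fun t => p + t • e₁ + t ^ 2 • e₂ with hP
  have hPc : Continuous P := by fun_prop
  have hP0 : P 0 = p := by simp [hP]
  have hPm : ∀ t, m (P t) - m p = t := by intro t; simp [hP, hm1, hm2]
  have hPl : ∀ t, l (P t) - l p = t ^ 2 := by intro t; simp [hP, hl1, hl2]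
  obtain ⟨ε, hε, hall⟩ : ∃ ε > 0, ∀ t : ℝ, |t| < ε → |t| < c / 2 ∧
      (∀ w, w ∉ B → t ^ 2 + c * |m (F w) - m p - t| < l (F w) - l p) ∧
      (∀ u w, u ∉ B → w ∉ B → u ≠ w → P t ∉ line[ℝ, F u, F w]) ∧ dist (P t) p < ρ := by
    have h1 : ∀ᶠ t in 𝓝 (0 : ℝ), |t| < c / 2 := by
      have : Tendsto (fun t : ℝ => |t|) (𝓝 0) (𝓝 |(0 : ℝ)|) := continuous_abs.tendsto 0
      exact this.eventually_lt_const (by simpa using hc)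
    have h2 : ∀ᶠ t in 𝓝 (0 : ℝ), ∀ w, w ∉ B →
        t ^ 2 + c * |m (F w) - m p - t| < l (F w) - l p := by
      refine eventually_all.2 fun w => ?_
      by_cases hw : w ∈ B
      · exact Eventually.of_forall fun _ h => absurd hw h
      have h3 : Tendsto (fun t : ℝ => t ^ 2 + c * |m (F w) - m p - t|) (𝓝 0)
          (𝓝 (0 ^ 2 + c * |m (F w) - m p - 0|)) :=
        Continuous.tendsto (by fun_prop) 0
      filter_upwards [h3.eventually_lt_const (by simpa using hcO w hw)] with t ht _ using ht
    have h3 : ∀ᶠ t in 𝓝 (0 : ℝ), ∀ u w, u ∉ B → w ∉ B → u ≠ w → P t ∉ line[ℝ, F u, F w] := by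
      refine eventually_all.2 fun u => eventually_all.2 fun w => ?_
      by_cases h : u ∉ B ∧ w ∉ B ∧ u ≠ w
      · have hcl : IsClosed (line[ℝ, F u, F w] : Set Plane) :=
          AffineSubspace.closed_of_finiteDimensional _
        have hp : P 0 ∈ (line[ℝ, F u, F w] : Set Plane)ᶜ := by
          rw [hP0]
          intro hmem
          exact hnc2 u h.1 w h.2.1 h.2.2 (collinear_insert_of_mem_affineSpan_pair hmem)
        filter_upwards [hPc.continuousAt (hcl.isOpen_compl.mem_nhds hp)] with t ht _ _ _ using ht
      · exact Eventually.of_forall fun _ a b c => absurd ⟨a, b, c⟩ h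
    have h4 : ∀ᶠ t in 𝓝 (0 : ℝ), dist (P t) p < ρ := by
      have : Tendsto P (𝓝 0) (𝓝 p) := by simpa [hP0] using hPc.tendsto 0
      exact this (Metric.ball_mem_nhds p hρ)
    obtain ⟨ε, hε, h⟩ := Metric.eventually_nhds_iff.1 (h1.and (h2.and (h3.and h4)))
    exact ⟨ε, hε, fun t ht => h (by simpa using ht)⟩
  -- parameters
  obtain ⟨τ, hτi, hτ⟩ : ∃ τ : V → ℝ, Function.Injective τ ∧ ∀ x, |τ x| < ε := by
    let e := Fintype.equivFin V
    refine ⟨fun x => ε * ((e x : ℕ) / ((Fintype.card V : ℝ) + 1)), ?_, ?_⟩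
    · intro x y hxy
      have hpos : (0 : ℝ) < (Fintype.card V : ℝ) + 1 := by positivity
      have h1 := mul_left_cancel₀ hε.ne' hxy
      rw [div_left_inj' hpos.ne'] at h1
      exact e.injective (Fin.ext (by exact_mod_cast h1))
    · intro x
      have hpos : (0 : ℝ) < (Fintype.card V : ℝ) + 1 := by positivity
      have hlt : ((e x : ℕ) : ℝ) < (Fintype.card V : ℝ) + 1 := by
        have := (e x).2
        have h2 : ((e x : ℕ) : ℝ) < Fintype.card V := by exact_mod_cast this
        linarith
      rw [abs_of_nonneg (by positivity)]
      have := (div_lt_one hpos).2 hlt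
      nlinarith
  have hτc : ∀ x, |τ x| < c / 2 := fun x => (hall _ (hτ x)).1
  have hsum : ∀ x y, |τ x + τ y| < c := fun x y =>
    lt_of_le_of_lt (abs_add_le _ _) (by linarith [hτc x, hτc y])
  set g : V → Plane := fun x => if x ∈ B then P (τ x) else F x with hg
  have hgB : ∀ b ∈ B, g b = P (τ b) := fun b hb => by simp [hg, hb]
  have hgO : ∀ x, x ∉ B → g x = F x := fun x hx => by simp [hg, hx]
  have hgm : ∀ b ∈ B, m (g b) - m p = τ b := fun b hb => by rw [hgB b hb, hPm]
  have hgl : ∀ b ∈ B, l (g b) - l p = τ b ^ 2 := fun b hb => by rw [hgB b hb, hPl]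
  have hO : ∀ b ∈ B, ∀ w, w ∉ B →
      τ b ^ 2 + c * |m (g w) - m p - τ b| < l (g w) - l p := by
    intro b _ w hw
    rw [hgO w hw]
    exact (hall _ (hτ b)).2.1 w hw
  have hclose : ∀ x, dist (g x) (F x) < ρ := by
    intro x
    by_cases hx : x ∈ B
    · rw [hgB x hx, hFB x hx]
      exact (hall _ (hτ x)).2.2.2
    · rw [hgO x hx, dist_self]; exact hρ
  -- chords lie below the other points
  have hchord : ∀ b ∈ B, ∀ b' ∈ B, ∀ w, w ∉ B →
      (τ b + τ b') * (m (g w) - m p) - τ b * τ b' < l (g w) - l p := by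
    intro b hb b' _ w hw
    have h1 := hO b hb w hw
    have h2 := slope_lt (y := m (g w) - m p - τ b) (hsum b b')
    nlinarith
  -- general position
  have c3 : ∀ x ∈ B, ∀ y ∈ B, ∀ z ∈ B, x ≠ y → x ≠ z → y ≠ z →
      ¬ Collinear ℝ ({g x, g y, g z} : Set Plane) := by
    intro x hx y hy z hz hxy hxz hyz hcol
    have h := collinear_det m l hcol
    have e1 : m (g y) - m (g x) = τ y - τ x := by linarith [hgm x hx, hgm y hy]
    have e2 : m (g z) - m (g x) = τ z - τ x := by linarith [hgm x hx, hgm z hz]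
    have e3 : l (g y) - l (g x) = τ y ^ 2 - τ x ^ 2 := by linarith [hgl x hx, hgl y hy]
    have e4 : l (g z) - l (g x) = τ z ^ 2 - τ x ^ 2 := by linarith [hgl x hx, hgl z hz]
    rw [e1, e2, e3, e4] at h
    have h5 : (τ y - τ x) * ((τ z - τ x) * (τ z - τ y)) = 0 := by linear_combination h
    rcases mul_eq_zero.1 h5 with h6 | h6
    · exact hxy (hτi (by linarith))
    · rcases mul_eq_zero.1 h6 with h7 | h7
      · exact hxz (hτi (by linarith))
      · exact hyz (hτi (by linarith))
  have c2 : ∀ x ∈ B, ∀ y ∈ B, ∀ z, z ∉ B → x ≠ y →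
      ¬ Collinear ℝ ({g x, g y, g z} : Set Plane) := by
    intro x hx y hy z hz hxy hcol
    have h := collinear_det m l hcol
    have e1 : m (g y) - m (g x) = τ y - τ x := by linarith [hgm x hx, hgm y hy]
    have e2 : m (g z) - m (g x) = m (g z) - m p - τ x := by linarith [hgm x hx]
    have e3 : l (g y) - l (g x) = τ y ^ 2 - τ x ^ 2 := by linarith [hgl x hx, hgl y hy]
    have e4 : l (g z) - l (g x) = l (g z) - l p - τ x ^ 2 := by linarith [hgl x hx]
    rw [e1, e2, e3, e4] at h
    have h5 : (τ y - τ x) * (l (g z) - l p - ((τ x + τ y) * (m (g z) - m p) - τ x * τ y)) = 0 := by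
      linear_combination h
    rcases mul_eq_zero.1 h5 with h6 | h6
    · exact hxy (hτi (by linarith))
    · linarith [hchord x hx y hy z hz]
  have c1 : ∀ x ∈ B, ∀ y, y ∉ B → ∀ z, z ∉ B → y ≠ z →
      ¬ Collinear ℝ ({g x, g y, g z} : Set Plane) := by
    intro x hx y hy z hz hyz hcol
    rw [hgB x hx, hgO y hy, hgO z hz] at hcol
    refine (hall _ (hτ x)).2.2.1 y z hy hz hyz ?_
    exact hcol.mem_affineSpan_of_mem_of_ne (by simp) (by simp) (by simp)
      (fun h => hyz (hinj y hy z hz h))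
  have hgp : ∀ x y z, x ≠ y → x ≠ z → y ≠ z →
      ¬ Collinear ℝ ({g x, g y, g z} : Set Plane) := by
    intro x y z hxy hxz hyz
    by_cases hx : x ∈ B <;> by_cases hy : y ∈ B <;> by_cases hz : z ∈ B
    · exact c3 x hx y hy z hz hxy hxz hyz
    · exact c2 x hx y hy z hz hxy
    · exact (not_collinear_perm (not_collinear_perm (c2 x hx z hz y hy hxz)).1).2
    · exact c1 x hx y hy z hz hyz
    · exact (not_collinear_perm (not_collinear_perm (c2 y hy z hz x hx hyz)).2).2
    · exact (not_collinear_perm (c1 y hy x hx z hz hxz)).1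
    · exact (not_collinear_perm (c1 z hz x hx y hy hxy)).2
    · rw [hgO x hx, hgO y hy, hgO z hz]
      exact hnc3 x hx y hy z hz hxy hxz hyz
  have hginj : Function.Injective g := by
    have hBO : ∀ x ∈ B, ∀ y, y ∉ B → g x ≠ g y := by
      intro x hx y hy h
      have h1 := hO x hx y hy
      rw [← h, hgm x hx, hgl x hx] at h1
      simp at h1
    intro x y hxy
    by_cases hx : x ∈ B <;> by_cases hy : y ∈ B
    · have h1 := hgm x hx
      rw [hxy, hgm y hy] at h1
      exact (hτi h1).symm
    · exact absurd hxy (hBO x hx y hy)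
    · exact absurd hxy.symm (hBO y hy x hx)
    · rw [hgO x hx, hgO y hy] at hxy
      exact hinj x hx y hy hxy
  have hbelow : ∀ b₀ ∈ B, ∀ z, (∀ b ∈ B, l z - l p < τ b ^ 2 + c * |m z - m p - τ b|) →
      z ∈ unb (edgeUnion H g) := fun b₀ hb₀ z hz =>
    below_unb H B hind g m l p e₂ hm2 hl2 τ c hc hgm hgl hO hb₀ hz
  refine ⟨g, _, finish_rep H g hginj ?_ ?_ ?_, ?_⟩
  · rintro _ ⟨x, rfl⟩ _ ⟨y, rfl⟩ _ ⟨z, rfl⟩ h1 h2 h3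
    exact hgp x y z (fun h => h1 (h ▸ rfl)) (fun h => h2 (h ▸ rfl)) (fun h => h3 (h ▸ rfl))
  · intro x y hxy hadj
    by_cases hB : x ∈ B ∧ y ∈ B
    swap
    · exact hρ1 x y hxy hadj hB g hclose
    obtain ⟨hx, hy⟩ := hB
    have hτne : τ y - τ x ≠ 0 := sub_ne_zero.2 (fun h => hxy (hτi h).symm)
    have hev : ∀ᶠ δ in 𝓝[>] (0 : ℝ), ∀ b, b ∈ B →
        τ x ^ 2 + δ * (τ y ^ 2 - τ x ^ 2) < τ b ^ 2 + c * |τ x + δ * (τ y - τ x) - τ b| := by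
      refine eventually_all.2 fun b => ?_
      by_cases hbx : b = x
      · subst hbx
        filter_upwards [self_mem_nhdsWithin] with δ hδ _
        have hδ' : 0 < δ := hδ
        rw [show τ b + δ * (τ y - τ b) - τ b = δ * (τ y - τ b) by ring, abs_mul, abs_of_pos hδ']
        have h1 := hsum y b
        have h2 : 0 < |τ y - τ b| := abs_pos.2 hτne
        have h3 : τ y ^ 2 - τ b ^ 2 ≤ |τ y + τ b| * |τ y - τ b| := by
          rw [← abs_mul]
          exact (le_of_eq (by ring)).trans (le_abs_self _)
        have h4 : τ y ^ 2 - τ b ^ 2 < c * |τ y - τ b| := by nlinarith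
        have := mul_lt_mul_of_pos_left h4 hδ'
        linarith
      · have hne : τ x ≠ τ b := fun h => hbx (hτi h).symm
        have h0 := parab_lt (hτc b) (hτc x) hne
        have t1 : Tendsto (fun δ : ℝ => τ x ^ 2 + δ * (τ y ^ 2 - τ x ^ 2)) (𝓝[>] 0)
            (𝓝 (τ x ^ 2 + 0 * (τ y ^ 2 - τ x ^ 2))) :=
          (Continuous.tendsto (by fun_prop) 0).mono_left nhdsWithin_le_nhds
        have t2 : Tendsto (fun δ : ℝ => τ b ^ 2 + c * |τ x + δ * (τ y - τ x) - τ b|) (𝓝[>] 0)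
            (𝓝 (τ b ^ 2 + c * |τ x + 0 * (τ y - τ x) - τ b|)) :=
          (Continuous.tendsto (by fun_prop) 0).mono_left nhdsWithin_le_nhds
        filter_upwards [t1.eventually_lt t2 (by simpa using h0)] with δ h _ using h
    obtain ⟨δ, hδ, hδ01⟩ := (hev.and (Ioo_mem_nhdsGT one_pos)).exists
    refine ⟨g x + δ • (g y - g x), ?_, hbelow x hx _ ?_⟩
    · rw [segment_eq_image']
      exact ⟨δ, ⟨hδ01.1.le, hδ01.2.le⟩, rfl⟩
    · intro b hb
      have h := hδ b hb
      have e1 : m (g x + δ • (g y - g x)) - m p - τ b = τ x + δ * (τ y - τ x) - τ b := by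
        simp only [map_add, map_smul, map_sub, smul_eq_mul]
        linear_combination (1 - δ) * hgm x hx + δ * hgm y hy
      have e2 : l (g x + δ • (g y - g x)) - l p = τ x ^ 2 + δ * (τ y ^ 2 - τ x ^ 2) := by
        simp only [map_add, map_smul, map_sub, smul_eq_mul]
        linear_combination (1 - δ) * hgl x hx + δ * hgl y hy
      rw [e1, e2]
      exact h
  · intro x
    by_cases hx : x ∈ B
    swap
    · exact hρ2 x hx g hclose (hgO x hx)
    have hlim : Tendsto (fun t : ℝ => g x - t • e₂) (𝓝[>] 0) (𝓝 (g x - (0 : ℝ) • e₂)) :=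
      (Continuous.tendsto (by fun_prop) 0).mono_left nhdsWithin_le_nhds
    rw [zero_smul, sub_zero] at hlim
    refine mem_closure_of_tendsto hlim ?_
    filter_upwards [self_mem_nhdsWithin] with t ht
    have ht' : 0 < t := ht
    refine hbelow x hx _ fun b hb => ?_
    simp only [map_sub, map_smul, smul_eq_mul, hm2, hl2, mul_zero, sub_zero, mul_one]
    rw [hgm x hx]
    have h1 := hgl x hx
    have h2 : τ x ^ 2 ≤ τ b ^ 2 + c * |τ x - τ b| := by
      by_cases hxb : τ x = τ b
      · rw [hxb]; simp
      · exact (parab_lt (hτc b) (hτc x) hxb).le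
    linarith
  · intro b hb hmem
    set φ : Plane →ₗ[ℝ] ℝ := (l - (2 * τ b) • m : Plane →L[ℝ] ℝ).toLinearMap with hφ
    have hφv : ∀ z, φ z = l z - 2 * τ b * m z := fun z => by simp [hφ]
    have hhalf : Convex ℝ {z | φ (g b) < φ z} := convex_halfSpace_gt φ.isLinear _
    have hsub : Set.range g \ {g b} ⊆ {z | φ (g b) < φ z} := by
      rintro _ ⟨⟨x, rfl⟩, hxb⟩
      have hxb' : x ≠ b := fun h => hxb (by rw [h]; rfl)
      show φ (g b) < φ (g x)
      rw [hφv, hφv]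
      have h1 := hgm b hb
      have h2 := hgl b hb
      by_cases hx : x ∈ B
      · have h3 := hgm x hx
        have h4 := hgl x hx
        have h5 : 0 < (τ x - τ b) ^ 2 := by
          have : τ x - τ b ≠ 0 := sub_ne_zero.2 fun h => hxb' (hτi h)
          positivity
        have e1 : m (g x) = m p + τ x := by linarith
        have e2 : m (g b) = m p + τ b := by linarith
        rw [e1, e2]
        nlinarith
      · have h3 := hchord b hb b hb x hx
        have e2 : m (g b) = m p + τ b := by linarith
        rw [e2]
        nlinarith
    have : φ (g b) < φ (g b) := convexHull_min hsub hhalf hmem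
    exact lt_irrefl _ this

/-- Let `v` be a vertex of `H` and `A` a set of non-adjacent twins of
`v` (not containing `v`).  If `G = H[Aᶜ]` has an exposed outside-obstacle representation
with `v` at an extreme point, then `H` has an exposed outside-obstacle representation in
which all vertices of `A ∪ {v}` are placed at extreme points. -/
theorem nonadjacent_twins_exposed_outsideObstacleRep
    {V : Type} [Fintype V] (H : SimpleGraph V) (v : V) (A : Set V) (hvA : v ∉ A)
    (htwin : ∀ a ∈ A, ¬ H.Adj a v ∧ ∀ u : V, H.Adj a u ↔ H.Adj v u)
    (hG : ∃ (f : ↥(Aᶜ) → Plane) (C : Set Plane),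
      IsExposedOutsideObstacleRep (H.induce Aᶜ) f C ∧
      IsExtremePt (f ⟨v, hvA⟩) (Set.range f)) :
    ∃ (f : V → Plane) (C : Set Plane),
      IsExposedOutsideObstacleRep H f C ∧
      ∀ a ∈ A ∪ {v}, IsExtremePt (f a) (Set.range f) := by
  classical
  obtain ⟨f, C, ⟨⟨⟨hfinj, hfgp, -, -, -, hadj⟩, hCU⟩, hexp⟩, hext⟩ := hG
  set p := f ⟨v, hvA⟩ with hp
  set F : V → Plane := fun x => if h : x ∈ A then p else f ⟨x, h⟩ with hF
  have hFA : ∀ x ∈ A, F x = p := fun x hx => by simp [hF, hx]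
  have hFO : ∀ x (h : x ∉ A), F x = f ⟨x, h⟩ := fun x hx => by simp [hF, hx]
  have hFB : ∀ b ∈ A ∪ {v}, F b = p := by
    rintro b (hb | hb)
    · exact hFA b hb
    · rw [Set.mem_singleton_iff.1 hb, hFO v hvA]
  have hA : ∀ x, x ∉ A ∪ {v} → x ∉ A := fun x hx h => hx (Or.inl h)
  have hv : ∀ x, x ∉ A ∪ {v} → x ≠ v := fun x hx h => hx (Or.inr h)
  have hinj : ∀ x, x ∉ A → ∀ y, y ∉ A → F x = F y → x = y := by
    intro x hx y hy h
    rw [hFO x hx, hFO y hy] at h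
    exact congrArg Subtype.val (hfinj h)
  have hFv : F v = p := hFO v hvA
  -- a representative outside `A` of each vertex
  have hrep : ∀ x, ∃ (x' : V) (h : x' ∉ A), F x = f ⟨x', h⟩ ∧ (∀ u, H.Adj x u ↔ H.Adj x' u) ∧
      (x ∉ A → x' = x) ∧ (x ∈ A → x' = v) := by
    intro x
    by_cases hx : x ∈ A
    · exact ⟨v, hvA, hFA x hx, (htwin x hx).2, fun h => absurd hx h, fun _ => rfl⟩
    · exact ⟨x, hx, hFO x hx, fun _ => Iff.rfl, fun _ => rfl, fun h => absurd h hx⟩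
  have hE : edgeUnion H F = edgeUnion (H.induce Aᶜ) f := by
    ext z
    rw [mem_edgeUnion, mem_edgeUnion]
    constructor
    · rintro ⟨u, w, huw, hz⟩
      obtain ⟨u', hu', hu1, hu2, -⟩ := hrep u
      obtain ⟨w', hw', hw1, hw2, -⟩ := hrep w
      refine ⟨⟨u', hu'⟩, ⟨w', hw'⟩, ?_, by rwa [← hu1, ← hw1]⟩
      show H.Adj u' w'
      exact ((hw2 u').1 ((hu2 w).1 huw).symm).symm
    · rintro ⟨⟨u, hu⟩, ⟨w, hw⟩, huw, hz⟩
      exact ⟨u, w, huw, by rwa [hFO u hu, hFO w hw]⟩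
  have hU : unb (edgeUnion H F) = outsideRegion (H.induce Aᶜ) f := by rw [hE]; rfl
  have hgp : ∀ x, x ∉ A → ∀ y, y ∉ A → ∀ z, z ∉ A → x ≠ y → x ≠ z → y ≠ z →
      ¬ Collinear ℝ ({F x, F y, F z} : Set Plane) := by
    intro x hx y hy z hz hxy hxz hyz
    have h1 := fun h => hxy (hinj x hx y hy h)
    have h2 := fun h => hxz (hinj x hx z hz h)
    have h3 := fun h => hyz (hinj y hy z hz h)
    exact hfgp _ ⟨_, (hFO x hx).symm⟩ _ ⟨_, (hFO y hy).symm⟩ _ ⟨_, (hFO z hz).symm⟩ h1 h2 h3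
  refine core H (A ∪ {v}) F p ?_ hFB ?_ ?_ ?_ ?_ ?_ ?_ ?_
  · rintro x hx y hy hxy
    have hvv : ∀ b ∈ A ∪ {v}, ∀ u, H.Adj b u ↔ H.Adj v u := by
      rintro b (hb | hb) u
      · exact (htwin b hb).2 u
      · rw [Set.mem_singleton_iff.1 hb]
    have h1 := (hvv x hx y).1 hxy
    have h2 := (hvv y hy v).1 h1.symm
    exact h2.ne rfl
  · intro x hx h
    exact hv x hx (hinj x (hA x hx) v hvA (h.trans hFv.symm))
  · intro x hx y hy
    exact hinj x (hA x hx) y (hA y hy)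
  · intro x hx y hy z hz
    exact hgp x (hA x hx) y (hA y hy) z (hA z hz)
  · intro x hx y hy hxy
    rw [← hFv]
    exact hgp v hvA x (hA x hx) y (hA y hy) (hv x hx).symm (hv y hy).symm hxy
  · intro x y hxy hna hnB
    obtain ⟨x', hx', hx1, hx2, hx3, hx4⟩ := hrep x
    obtain ⟨y', hy', hy1, hy2, hy3, hy4⟩ := hrep y
    have hne : (⟨x', hx'⟩ : ↥(Aᶜ)) ≠ ⟨y', hy'⟩ := by
      intro h
      have h' : x' = y' := congrArg Subtype.val h
      by_cases hxA : x ∈ A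
      · by_cases hyA : y ∈ A
        · exact hnB ⟨Or.inl hxA, Or.inl hyA⟩
        · rw [hx4 hxA, hy3 hyA] at h'
          exact hnB ⟨Or.inl hxA, Or.inr h'.symm⟩
      · by_cases hyA : y ∈ A
        · rw [hx3 hxA, hy4 hyA] at h'
          exact hnB ⟨Or.inr h', Or.inl hyA⟩
        · rw [hx3 hxA, hy3 hyA] at h'
          exact hxy h'
    have hna' : ¬ (H.induce Aᶜ).Adj ⟨x', hx'⟩ ⟨y', hy'⟩ := by
      intro h
      have h1 : H.Adj x' y' := h
      exact hna ((hx2 y).2 ((hy2 x').2 h1.symm).symm)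
    rw [hadj _ _ hne, Set.not_disjoint_iff] at hna'
    obtain ⟨z, hz, hzC⟩ := hna'
    refine ⟨z, by rwa [hx1, hy1], ?_⟩
    rw [hU]
    exact hCU hzC
  · intro x hx
    rw [hU, hFO x (hA x hx)]
    exact hexp _
  · intro h
    apply hext
    refine convexHull_mono ?_ h
    rintro _ ⟨x, hx, rfl⟩
    refine ⟨⟨_, (hFO x (hA x hx)).symm⟩, ?_⟩
    intro h2
    exact hv x hx (hinj x (hA x hx) v hvA ((Set.mem_singleton_iff.1 h2).trans hFv.symm))

end
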